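/- (Nondemolition property.) For every d×d complex matrix X (identified with X ⊗ I on the total space) and all indices with N ≥ l ≥ k ≥ 1, the evolved system observable commutes with the earlier output increments: [j_l(X), ΔY(k)] = 0. -/

import Mathlib

open Matrix
open scoped ComplexOrder BigOperators

noncomputable section DiscreteField

/-- Index set of the total Hilbert space `ℂ^d ⊗ (ℂ²)^{⊗N}`. -/
abbrev TIdx (d N : ℕ) := Fin d × (Fin N → Fin 2)

/-- Operators on the total Hilbert space. -/
abbrev TOp (d N : ℕ) := Matrix (TIdx d N) (TIdx d N) ℂ

/-- The lowering operator `σ₋` (entry `(2,1)` equal to `1`). -/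
def sigmaMinus : Matrix (Fin 2) (Fin 2) ℂ := !![0, 0; 1, 0]

/-- The raising operator `σ₊ = σ₋*`. -/
def sigmaPlus : Matrix (Fin 2) (Fin 2) ℂ := star sigmaMinus

/-- The operator acting as the 2×2 matrix `X` on the `l`-th field slice and as the
identity on the system and on all other slices. -/
def sliceOp {d N : ℕ} (l : Fin N) (X : Matrix (Fin 2) (Fin 2) ℂ) : TOp d N :=
  Matrix.of fun p q =>
    if p.1 = q.1 ∧ ∀ i : Fin N, i ≠ l → p.2 i = q.2 i then X (p.2 l) (q.2 l) else 0

/-- The operator acting as the d×d matrix `S` on the system and as the identity on the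
field, i.e. `S ⊗ I`. -/
def sys {d N : ℕ} (S : Matrix (Fin d) (Fin d) ℂ) : TOp d N :=
  Matrix.of fun p q => if p.2 = q.2 then S p.1 q.1 else 0

variable {d N : ℕ}

/-- `ΔA(l) = λ (σ₋)_l`. -/
def dA (lam : ℝ) (l : Fin N) : TOp d N := (lam : ℂ) • sliceOp l sigmaMinus

/-- `ΔΛ(l) = (σ₊σ₋)_l`. -/
def dLam (l : Fin N) : TOp d N := sliceOp l (sigmaPlus * sigmaMinus)

/-- `Δt(l) = λ² I`. -/
def dt (d N : ℕ) (lam : ℝ) : TOp d N := ((lam : ℂ) ^ 2) • 1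

/-- `ΔW(l) = ΔA(l) + ΔA(l)*`. -/
def dW (lam : ℝ) (l : Fin N) : TOp d N := dA lam l + star (dA lam l)

variable (lam : ℝ) (Mpm Mp Mm Mo : Matrix (Fin d) (Fin d) ℂ)

/-- `M_l = I + Mpm ΔΛ(l) + Mp ΔA(l)* + Mm ΔA(l) + Mo Δt(l)`. -/
def Mmat (l : Fin N) : TOp d N :=
  1 + sys Mpm * dLam l + sys Mp * star (dA lam l) + sys Mm * dA lam l + sys Mo * dt d N lam

/-- `U(0) = I`, `U(l) = M_l U(l−1)` (slices are 0-indexed: paper `M_{l+1}` is `Mmat ⟨l,_⟩`). -/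
def Umat : ℕ → TOp d N
  | 0 => 1
  | l + 1 => (if h : l < N then Mmat lam Mpm Mp Mm Mo ⟨l, h⟩ else 1) * Umat l

/-- The flow `j_l(X) = U(l)* X U(l)`. -/
def jmap (l : ℕ) (X : TOp d N) : TOp d N :=
  star (Umat lam Mpm Mp Mm Mo l) * X * Umat lam Mpm Mp Mm Mo l

/-- The output increment `ΔY(l) = U(l)* ΔW(l) U(l)` (for `l : Fin N`, this is the paper's
`ΔY(l+1)`, i.e. paper-time `l+1`). -/
def dY (l : Fin N) : TOp d N :=
  star (Umat lam Mpm Mp Mm Mo (l.1 + 1)) * dW lam l * Umat lam Mpm Mp Mm Mo (l.1 + 1)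

end DiscreteField

theorem star_sliceOp {d N : ℕ} (l : Fin N) (X : Matrix (Fin 2) (Fin 2) ℂ) :
    star (sliceOp l X : TOp d N) = sliceOp l (star X) := by
  ext p q
  simp only [star_apply, sliceOp, of_apply, apply_ite star, star_zero]
  simp only [eq_comm]

/-- An operator acting trivially on slice `k` commutes with every operator on slice `k`. -/
theorem commute_sliceOp {d N : ℕ} (k : Fin N) (A : Matrix (Fin 2) (Fin 2) ℂ) (B : TOp d N)
    (hdiag : ∀ p q, p.2 k ≠ q.2 k → B p q = 0)
    (hshift : ∀ p q, B (p.1, Function.update p.2 k (q.2 k)) q =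
      B p (q.1, Function.update q.2 k (p.2 k))) :
    Commute (sliceOp k A) B := by
  ext p q
  rw [mul_apply, mul_apply,
    Finset.sum_eq_single (p.1, Function.update p.2 k (q.2 k)),
    Finset.sum_eq_single (q.1, Function.update q.2 k (p.2 k)), hshift]
  · have h₁ : ∀ i, i ≠ k → p.2 i = Function.update p.2 k (q.2 k) i := fun i hi => by simp [hi]
    have h₂ : ∀ i, i ≠ k → Function.update q.2 k (p.2 k) i = q.2 i := fun i hi => by simp [hi]
    simp only [sliceOp, of_apply, true_and, if_pos h₁, if_pos h₂, Function.update_self]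
    exact mul_comm _ _
  · intro r _ hr
    by_cases hk : p.2 k = r.2 k
    · rw [sliceOp, of_apply, if_neg, mul_zero]
      rintro ⟨h₁, h₂⟩
      refine hr (Prod.ext h₁ (funext fun i => ?_))
      by_cases hi : i = k
      · subst hi; simp [hk]
      · simp [hi, h₂ i hi]
    · rw [hdiag p r hk, zero_mul]
  · simp
  · intro r _ hr
    by_cases hk : r.2 k = q.2 k
    · rw [sliceOp, of_apply, if_neg, zero_mul]
      rintro ⟨h₁, h₂⟩
      refine hr (Prod.ext h₁.symm (funext fun i => ?_))
      by_cases hi : i = k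
      · subst hi; simp [hk]
      · simp [hi, h₂ i hi]
    · rw [hdiag r q hk, mul_zero]
  · simp

theorem commute_sliceOp_sys {d N : ℕ} (k : Fin N) (A : Matrix (Fin 2) (Fin 2) ℂ)
    (S : Matrix (Fin d) (Fin d) ℂ) : Commute (sliceOp k A : TOp d N) (sys S) := by
  refine commute_sliceOp k A _ (fun p q h => ?_) (fun p q => ?_)
  · exact if_neg fun e => h (congrFun e k)
  · simp only [sys, of_apply, Function.update_eq_iff, Function.eq_update_iff, true_and]

theorem commute_sliceOp_sliceOp {d N : ℕ} {k m : Fin N} (hkm : k ≠ m)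
    (A B : Matrix (Fin 2) (Fin 2) ℂ) : Commute (sliceOp k A : TOp d N) (sliceOp m B) := by
  refine commute_sliceOp k A _ (fun p q h => ?_) (fun p q => ?_)
  · exact if_neg fun e => h (e.2 k hkm)
  · simp only [sliceOp, of_apply, Function.update_of_ne hkm.symm]
    refine if_congr (and_congr_right fun _ => forall₂_congr fun i _ => ?_) rfl rfl
    by_cases hi : i = k
    · subst hi; simp
    · simp [hi]

theorem dW_eq_sliceOp {d N : ℕ} (lam : ℝ) (k : Fin N) : (dW lam k : TOp d N) =
    (lam : ℂ) • sliceOp k sigmaMinus + star (lam : ℂ) • sliceOp k (star sigmaMinus) := by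
  rw [dW, dA, star_smul, star_sliceOp]

theorem commute_dW_sys {d N : ℕ} (lam : ℝ) (k : Fin N) (S : Matrix (Fin d) (Fin d) ℂ) :
    Commute (dW lam k : TOp d N) (sys S) := by
  rw [dW_eq_sliceOp]
  exact ((commute_sliceOp_sys k _ S).smul_left _).add_left
    ((commute_sliceOp_sys k _ S).smul_left _)

theorem commute_dW_sliceOp {d N : ℕ} (lam : ℝ) {k m : Fin N} (hkm : k ≠ m)
    (B : Matrix (Fin 2) (Fin 2) ℂ) : Commute (dW lam k : TOp d N) (sliceOp m B) := by
  rw [dW_eq_sliceOp]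
  exact ((commute_sliceOp_sliceOp hkm _ B).smul_left _).add_left
    ((commute_sliceOp_sliceOp hkm _ B).smul_left _)

theorem commute_dW_Mmat {d N : ℕ} (lam : ℝ) (Mpm Mp Mm Mo : Matrix (Fin d) (Fin d) ℂ)
    {k m : Fin N} (hkm : k ≠ m) : Commute (dW lam k) (Mmat lam Mpm Mp Mm Mo m) := by
  have hsys := commute_dW_sys (d := d) lam k
  have hslice := commute_dW_sliceOp (d := d) lam hkm
  rw [Mmat, dLam, dA, dt, star_smul, star_sliceOp]
  exact ((((Commute.one_right _).add_right ((hsys Mpm).mul_right (hslice _))).add_right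
    ((hsys Mp).mul_right ((hslice _).smul_right _))).add_right
    ((hsys Mm).mul_right ((hslice _).smul_right _))).add_right
    ((hsys Mo).mul_right ((Commute.one_right _).smul_right _))

theorem Umat_mem_unitaryGroup {d N : ℕ} {lam : ℝ} {Mpm Mp Mm Mo : Matrix (Fin d) (Fin d) ℂ}
    (hU : ∀ l : Fin N, Mmat lam Mpm Mp Mm Mo l ∈ unitaryGroup (TIdx d N) ℂ) (l : ℕ) :
    Umat lam Mpm Mp Mm Mo l ∈ unitaryGroup (TIdx d N) ℂ := by
  induction l with
  | zero => exact one_mem _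
  | succ l ih =>
    rw [Umat]
    refine mul_mem ?_ ih
    split_ifs with h
    exacts [hU ⟨l, h⟩, one_mem _]

/-- The output increment at slice `k` may be computed with the propagator at any later time. -/
theorem dY_eq_jmap {d N : ℕ} {lam : ℝ} {Mpm Mp Mm Mo : Matrix (Fin d) (Fin d) ℂ}
    (hU : ∀ l : Fin N, Mmat lam Mpm Mp Mm Mo l ∈ unitaryGroup (TIdx d N) ℂ)
    (k : Fin N) {l : ℕ} (hkl : k.1 + 1 ≤ l) :
    dY lam Mpm Mp Mm Mo k = jmap lam Mpm Mp Mm Mo l (dW lam k) := by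
  induction l, hkl using Nat.le_induction with
  | base => rfl
  | succ l hkl ih =>
    rw [ih, jmap, jmap, Umat]
    split_ifs with h
    · have hkm : k ≠ ⟨l, h⟩ := fun e => by simp [e] at hkl
      have hcomm := (commute_dW_Mmat lam Mpm Mp Mm Mo hkm).eq
      have hM := mem_unitaryGroup_iff'.mp (hU ⟨l, h⟩)
      have hconj : star (Mmat lam Mpm Mp Mm Mo ⟨l, h⟩) * dW lam k *
          Mmat lam Mpm Mp Mm Mo ⟨l, h⟩ = dW lam k := by
        rw [mul_assoc, hcomm, ← mul_assoc, hM, one_mul]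
      conv_lhs => rw [← hconj]
      simp only [star_mul, mul_assoc]
    · rw [one_mul]

theorem jmap_mul {d N : ℕ} {lam : ℝ} {Mpm Mp Mm Mo : Matrix (Fin d) (Fin d) ℂ}
    (hU : ∀ l : Fin N, Mmat lam Mpm Mp Mm Mo l ∈ unitaryGroup (TIdx d N) ℂ) (l : ℕ)
    (A B : TOp d N) : jmap lam Mpm Mp Mm Mo l (A * B) =
      jmap lam Mpm Mp Mm Mo l A * jmap lam Mpm Mp Mm Mo l B := by
  have h := mem_unitaryGroup_iff.mp (Umat_mem_unitaryGroup hU l)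
  simp only [jmap, mul_assoc]
  rw [← mul_assoc (Umat lam Mpm Mp Mm Mo l) (star _), h, one_mul]

/-- Nondemolition property: for `N ≥ l ≥ k ≥ 1`, the evolved system observable
`j_l(X) = U(l)* (X ⊗ I) U(l)` commutes with the earlier output increments,
`[j_l(X), ΔY(k)] = 0`. (Here `k : Fin N` denotes the paper's time `k+1`, so the paper
condition `k ≤ l` reads `k.1 + 1 ≤ l`.) -/
theorem output_nondemolition {d N : ℕ} (hd : 0 < d) {lam : ℝ}
    (hlam : 0 < lam) (Mpm Mp Mm Mo : Matrix (Fin d) (Fin d) ℂ)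
    (hU : ∀ l : Fin N, Mmat lam Mpm Mp Mm Mo l ∈ Matrix.unitaryGroup (TIdx d N) ℂ)
    (X : Matrix (Fin d) (Fin d) ℂ) (l : ℕ) (k : Fin N) (hkl : k.1 + 1 ≤ l) (hlN : l ≤ N) :
    jmap lam Mpm Mp Mm Mo l (sys X) * dY lam Mpm Mp Mm Mo k -
      dY lam Mpm Mp Mm Mo k * jmap lam Mpm Mp Mm Mo l (sys X) = 0 := by
  rw [dY_eq_jmap hU k hkl, ← jmap_mul hU, ← jmap_mul hU, (commute_dW_sys lam k X).eq, sub_self]
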